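/- Let G be a word-representable graph with at least two vertices and representation number R(G) = k, let y be a vertex of G, and let G' be the graph obtained from G by adding one new vertex x together with the single edge (x,y). Then G' is word-representable and R(G') = max(k, 2). -/

import Mathlib

/-- Two letters `x` and `y` alternate in the word `w` if, after deleting all letters
other than `x` and `y`, no two equal letters are consecutive. -/
def Alternate {V : Type*} [DecidableEq V] (w : List V) (x y : V) : Prop :=
  (w.filter (fun z => decide (z = x ∨ z = y))).Chain' (· ≠ ·)

/-- A word `w` represents the graph `G` if every vertex occurs in `w` and two distinct
vertices alternate in `w` exactly when they are adjacent in `G`. -/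
def Represents {V : Type*} [DecidableEq V] (w : List V) (G : SimpleGraph V) : Prop :=
  (∀ v : V, v ∈ w) ∧ ∀ x y : V, x ≠ y → (Alternate w x y ↔ G.Adj x y)

/-- A graph is word-representable if some word represents it. -/
def WordRepresentable {V : Type*} [DecidableEq V] (G : SimpleGraph V) : Prop :=
  ∃ w : List V, Represents w G

/-- A word is `k`-uniform if every letter occurs in it exactly `k` times. -/
def KUniform {V : Type*} [DecidableEq V] (k : ℕ) (w : List V) : Prop :=
  ∀ v : V, w.count v = k

/-- A graph is `k`-word-representable if some `k`-uniform word represents it. -/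
def KRepresentable {V : Type*} [DecidableEq V] (G : SimpleGraph V) (k : ℕ) : Prop :=
  ∃ w : List V, KUniform k w ∧ Represents w G

/-- The representation number of a graph: the least `k` such that it is
`k`-word-representable. -/
noncomputable def reprNum {V : Type*} [DecidableEq V] (G : SimpleGraph V) : ℕ :=
  sInf {k | KRepresentable G k}

theorem List.isChain_ne_reverse {α : Type*} {l : List α} :
    l.reverse.IsChain (· ≠ ·) ↔ l.IsChain (· ≠ ·) := by
  rw [List.isChain_reverse]
  simp only [ne_comm]

section ListLemmas

variable {α : Type*} [DecidableEq α]

theorem List.filter_dedup_eq_dedup_filter (p : α → Bool) (l : List α) :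
    l.dedup.filter p = (l.filter p).dedup := by
  induction l with
  | nil => simp
  | cons a l ih =>
    by_cases ha : a ∈ l <;> by_cases hp : p a <;>
      simp [List.dedup_cons_of_mem, List.dedup_cons_of_notMem, ha, hp, ih]

theorem List.getLast?_dedup (l : List α) : l.dedup.getLast? = l.getLast? := by
  induction l with
  | nil => simp
  | cons a l ih =>
    by_cases ha : a ∈ l
    · rw [List.dedup_cons_of_mem ha, ih]
      cases l with
      | nil => simp at ha
      | cons b l => simp [List.getLast?_cons_cons]
    · rw [List.dedup_cons_of_notMem ha, List.getLast?_cons, List.getLast?_cons, ih]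

/-- A word without repeated consecutive letters that contains two different letters can be
followed by its deduplication. -/
theorem List.isChain_ne_append_dedup {l : List α} {x y : α} (hxy : x ≠ y) (hx : x ∈ l)
    (hy : y ∈ l) (hl : l.IsChain (· ≠ ·)) : (l ++ l.dedup).IsChain (· ≠ ·) := by
  rw [List.isChain_append]
  refine ⟨hl, List.Pairwise.isChain l.nodup_dedup, ?_⟩
  rintro a ha b hb rfl
  rw [← List.getLast?_dedup] at ha
  have hnd := l.nodup_dedup
  have hx' := List.mem_dedup.2 hx
  have hy' := List.mem_dedup.2 hy
  generalize l.dedup = d at *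
  match d with
  | [] => simp at hx'
  | [c] => simp_all
  | c :: e :: r =>
    simp only [List.head?_cons, Option.mem_def, Option.some.injEq] at hb
    subst hb
    rw [List.getLast?_cons_cons] at ha
    exact (List.nodup_cons.1 hnd).1 (List.mem_of_getLast? ha)

end ListLemmas

section CountLemmas

variable {α : Type*} [BEq α] [LawfulBEq α]

/-- In an alternating word in `x` and `y` starting with `x`, the number of occurrences of `x`
equals that of `y` or exceeds it by one. -/
theorem List.count_le_of_isChain_ne_cons {l : List α} {x y : α} (hxy : x ≠ y)
    (hl : ∀ z ∈ l, z = x ∨ z = y) (hc : (x :: l).IsChain (· ≠ ·)) :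
    l.count y ≤ l.count x + 1 ∧ l.count x ≤ l.count y := by
  induction l generalizing x y with
  | nil => simp
  | cons a l ih =>
    rw [List.isChain_cons_cons] at hc
    obtain rfl : a = y := (hl a (by simp)).resolve_left (Ne.symm hc.1)
    have := ih hxy.symm (fun z hz => (hl z (by simp [hz])).symm) hc.2
    rw [List.count_cons_self, List.count_cons_of_ne hxy.symm]
    lia

theorem List.isChain_ne_cons_of_count_lt {l : List α} {x y : α} (hxy : x ≠ y)
    (hl : ∀ z ∈ l, z = x ∨ z = y) (hc : l.IsChain (· ≠ ·)) (hlt : l.count x < l.count y) :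
    (x :: l).IsChain (· ≠ ·) := by
  cases l with
  | nil => simp
  | cons a l =>
    refine List.isChain_cons_cons.2 ⟨?_, hc⟩
    rintro rfl
    have := (List.count_le_of_isChain_ne_cons hxy (fun z hz => hl z (by simp [hz])) hc).1
    rw [List.count_cons_self, List.count_cons_of_ne hxy] at hlt
    lia

theorem List.isChain_ne_concat_of_count_lt {l : List α} {x y : α} (hxy : x ≠ y)
    (hl : ∀ z ∈ l, z = x ∨ z = y) (hc : l.IsChain (· ≠ ·)) (hlt : l.count x < l.count y) :
    (l ++ [x]).IsChain (· ≠ ·) := by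
  rw [← List.isChain_ne_reverse] at hc ⊢
  rw [List.reverse_concat]
  exact List.isChain_ne_cons_of_count_lt hxy (by simpa using hl) hc (by simpa using hlt)

end CountLemmas

section Alternation

variable {V : Type*} [DecidableEq V]

/-- Uniformity does not depend on the Boolean equality used for counting. -/
theorem kUniform_iff [inst : BEq V] [LawfulBEq V] {k : ℕ} {w : List V} :
    KUniform k w ↔ ∀ v, w.count v = k := by
  obtain rfl : inst = instBEqOfDecidableEq := lawful_beq_subsingleton _ _
  rfl

theorem alternate_iff {w : List V} {x y : V} :
    Alternate w x y ↔ (w.filter (fun z => decide (z = x ∨ z = y))).IsChain (· ≠ ·) :=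
  Iff.rfl

theorem alternate_comm {w : List V} {x y : V} : Alternate w x y ↔ Alternate w y x := by
  simp only [alternate_iff, or_comm]

theorem forall_mem_filter_pair (w : List V) (x y : V) :
    ∀ z ∈ w.filter (fun z => decide (z = x ∨ z = y)), z = x ∨ z = y := by
  intro z hz
  simpa using (List.mem_filter.1 hz).2

theorem count_filter_pair_left [BEq V] [LawfulBEq V] (w : List V) (x y : V) :
    (w.filter (fun z => decide (z = x ∨ z = y))).count x = w.count x :=
  List.count_filter (by simp)

theorem count_filter_pair_right [BEq V] [LawfulBEq V] (w : List V) (x y : V) :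
    (w.filter (fun z => decide (z = x ∨ z = y))).count y = w.count y :=
  List.count_filter (by simp)

theorem Alternate.of_append_left {u v : List V} {x y : V} (h : Alternate (u ++ v) x y) :
    Alternate u x y := by
  rw [alternate_iff, List.filter_append] at h
  exact h.left_of_append

theorem filter_pair_filter_dedup {w : List V} {x y : V} {p : V → Bool} (hx : x ∈ w)
    (hpx : p x) (hpy : ¬ p y) :
    (w.dedup.filter p).filter (fun z => decide (z = x ∨ z = y)) = [x] := by
  have h : (w.dedup.filter p).filter (fun z => decide (z = x ∨ z = y)) =
      w.dedup.filter (· == x) := by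
    rw [List.filter_filter]
    refine List.filter_congr fun z _ => ?_
    by_cases hzx : z = x
    · subst hzx; simp [hpx]
    · by_cases hzy : z = y
      · subst hzy; simp [hpy, hzx]
      · simp [hzx, hzy]
  rw [h, List.filter_beq, List.count_dedup, if_pos hx]
  rfl

/-- A representing word may be extended by the last occurrences of the letters satisfying `p`,
provided these letters occur less often than all others. -/
theorem Represents.append_filter_dedup {w : List V} {G : SimpleGraph V} (h : Represents w G)
    {p : V → Bool} (hp : ∀ x y, p x → ¬ p y → w.count x < w.count y) :
    Represents (w ++ w.dedup.filter p) G := by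
  have key : ∀ x y, x ≠ y → Alternate w x y → p x → ¬ p y →
      Alternate (w ++ w.dedup.filter p) x y := by
    intro x y hxy hw hpx hpy
    rw [alternate_iff, List.filter_append, filter_pair_filter_dedup (h.1 x) hpx hpy]
    refine List.isChain_ne_concat_of_count_lt hxy (forall_mem_filter_pair w x y) hw ?_
    rw [count_filter_pair_left, count_filter_pair_right]
    exact hp x y hpx hpy
  refine ⟨fun v => List.mem_append_left _ (h.1 v), fun x y hxy => ?_⟩
  rw [← h.2 x y hxy]
  refine ⟨Alternate.of_append_left, fun hw => ?_⟩
  by_cases hpx : p x <;> by_cases hpy : p y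
  · have hd : (w.dedup.filter p).filter (fun z => decide (z = x ∨ z = y)) =
        (w.filter (fun z => decide (z = x ∨ z = y))).dedup := by
      rw [← List.filter_dedup_eq_dedup_filter, List.filter_filter]
      refine List.filter_congr fun z _ => ?_
      by_cases hz : z = x ∨ z = y
      · rcases hz with rfl | rfl <;> simp [*]
      · simp [hz]
    rw [alternate_iff, List.filter_append, hd]
    exact List.isChain_ne_append_dedup hxy (by simpa using h.1 x) (by simpa using h.1 y) hw
  · exact key x y hxy hw hpx hpy
  · exact alternate_comm.1 (key y x hxy.symm (alternate_comm.1 hw) hpy hpx)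
  · have hd : (w.dedup.filter p).filter (fun z => decide (z = x ∨ z = y)) = [] := by
      rw [List.filter_eq_nil_iff]
      intro z hz hz'
      have hpz := (List.mem_filter.1 hz).2
      rcases of_decide_eq_true hz' with rfl | rfl <;> contradiction
    rwa [alternate_iff, List.filter_append, hd, List.append_nil]

theorem Represents.count_append_filter_dedup {w : List V} {G : SimpleGraph V}
    (h : Represents w G) (p : V → Bool) (v : V) :
    (w ++ w.dedup.filter p).count v = w.count v + if p v then 1 else 0 := by
  rw [List.count_append]
  congr 1
  split_ifs with hv
  · rw [List.count_filter hv, List.count_dedup, if_pos (h.1 v)]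
  · exact List.count_eq_zero.2 fun hm => hv (List.mem_filter.1 hm).2

theorem WordRepresentable.exists_kRepresentable {G : SimpleGraph V}
    (hG : WordRepresentable G) : ∃ k, KRepresentable G k := by
  obtain ⟨w₀, h₀⟩ := hG
  have key : ∀ n ≤ w₀.length, ∃ w, Represents w G ∧
      ∀ v, n ≤ w.count v ∧ w.count v ≤ w₀.length := by
    intro n
    induction n with
    | zero => exact fun _ => ⟨w₀, h₀, fun v => ⟨Nat.zero_le _, List.count_le_length⟩⟩
    | succ n ih =>
      intro hn
      obtain ⟨w, hw, hc⟩ := ih (by lia)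
      refine ⟨w ++ w.dedup.filter (fun v => decide (w.count v < w₀.length)),
        hw.append_filter_dedup ?_, fun v => ?_⟩
      · intro x y hx hy
        simp only [decide_eq_true_eq] at hx hy
        lia
      · rw [hw.count_append_filter_dedup]
        have := hc v
        simp only [decide_eq_true_eq]
        split_ifs <;> lia
  obtain ⟨w, hw, hc⟩ := key _ le_rfl
  exact ⟨w₀.length, w, fun v => le_antisymm (hc v).2 (hc v).1, hw⟩

theorem KRepresentable.mono {G : SimpleGraph V} {k m : ℕ} (h : KRepresentable G k)
    (hkm : k ≤ m) : KRepresentable G m := by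
  induction m, hkm using Nat.le_induction with
  | base => exact h
  | succ m _ ih =>
    obtain ⟨w, hu, hw⟩ := ih
    refine ⟨w ++ w.dedup.filter (fun _ => true), fun v => ?_,
      hw.append_filter_dedup (by simp)⟩
    rw [hw.count_append_filter_dedup, hu v, if_pos rfl]

theorem KRepresentable.reprNum_le {G : SimpleGraph V} {k : ℕ} (h : KRepresentable G k) :
    reprNum G ≤ k :=
  Nat.sInf_le h

theorem WordRepresentable.kRepresentable_reprNum {G : SimpleGraph V}
    (hG : WordRepresentable G) : KRepresentable G (reprNum G) :=
  Nat.sInf_mem hG.exists_kRepresentable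

theorem alternate_cons_iff_alternate_concat {a : V} {u : List V} {x y : V} (hxy : x ≠ y)
    (hc : (a :: u).count x = (a :: u).count y) :
    Alternate (a :: u) x y ↔ Alternate (u ++ [a]) x y := by
  have key : ∀ {x y : V}, x ≠ y → (x :: u).count x = (x :: u).count y →
      (Alternate (x :: u) x y ↔ Alternate (u ++ [x]) x y) := by
    intro x y hxy hc
    rw [List.count_cons_self, List.count_cons_of_ne hxy] at hc
    have hlt : (u.filter (fun z => decide (z = x ∨ z = y))).count x <
        (u.filter (fun z => decide (z = x ∨ z = y))).count y := by
      rw [count_filter_pair_left, count_filter_pair_right]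
      lia
    have hm := forall_mem_filter_pair u x y
    rw [alternate_iff, alternate_iff, List.filter_append, List.filter_cons_of_pos (by simp),
      List.filter_cons_of_pos (by simp), List.filter_nil]
    exact ⟨fun h => List.isChain_ne_concat_of_count_lt hxy hm h.tail hlt,
      fun h => List.isChain_ne_cons_of_count_lt hxy hm h.left_of_append hlt⟩
  by_cases hx : a = x
  · subst hx
    exact key hxy hc
  by_cases hy : a = y
  · subst hy
    rw [alternate_comm, key hxy.symm hc.symm, alternate_comm]
  simp [alternate_iff, hx, hy]

theorem KUniform.perm {k : ℕ} {w w' : List V} (h : KUniform k w) (hp : w.Perm w') :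
    KUniform k w' :=
  fun v => hp.count_eq v ▸ h v

/-- Cyclic shifts of a uniform word represent the same graph. -/
theorem Represents.append_comm {G : SimpleGraph V} {k : ℕ} {u v : List V}
    (hu : KUniform k (u ++ v)) (h : Represents (u ++ v) G) : Represents (v ++ u) G := by
  induction u generalizing v with
  | nil => simpa using h
  | cons a u ih =>
    have hperm : (a :: u ++ v).Perm (u ++ (v ++ [a])) := by
      rw [← List.append_assoc, List.cons_append]
      exact (List.perm_append_singleton a (u ++ v)).symm
    have := ih (v := v ++ [a]) (hu.perm hperm) ⟨fun z => hperm.mem_iff.1 (h.1 z), fun x y hxy => ?_⟩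
    · simpa using this
    · rw [← h.2 x y hxy, ← List.append_assoc, List.cons_append]
      exact (alternate_cons_iff_alternate_concat hxy ((hu x).trans (hu y).symm)).symm

end Alternation

section Pendant

variable {V : Type*} [DecidableEq V]

theorem count_reduceOption (w : List (Option V)) (v : V) :
    w.reduceOption.count v = w.count (some v) := by
  induction w with
  | nil => simp
  | cons a w ih =>
    cases a with
    | none => simpa using ih
    | some a => simp [List.count_cons, ih]

theorem alternate_reduceOption {w : List (Option V)} {a b : V} :
    Alternate w.reduceOption a b ↔ Alternate w (some a) (some b) := by
  have h : w.filter (fun z => decide (z = some a ∨ z = some b)) =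
      (w.reduceOption.filter (fun z => decide (z = a ∨ z = b))).map some := by
    induction w with
    | nil => simp
    | cons c w ih =>
      cases c with
      | none => simpa using ih
      | some c =>
        simp only [List.reduceOption_cons_of_some, List.filter_cons, Option.some.injEq, ih]
        split_ifs <;> simp
  rw [alternate_iff, alternate_iff, h, List.isChain_map]
  simp

/-- Insert the new letter `none` immediately before every occurrence of `y`. -/
def insertBefore (y : V) (w : List V) : List (Option V) :=
  w.flatMap fun z => if z = y then [none, some z] else [some z]

theorem reduceOption_insertBefore (y : V) (w : List V) :
    (insertBefore y w).reduceOption = w := by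
  induction w with
  | nil => rfl
  | cons a w ih =>
    rw [insertBefore, List.flatMap_cons, List.reduceOption_append, ← insertBefore, ih]
    split_ifs <;> simp

theorem count_none_insertBefore (y : V) (w : List V) :
    (insertBefore y w).count none = w.count y := by
  induction w with
  | nil => rfl
  | cons a w ih =>
    rw [insertBefore, List.flatMap_cons, List.count_append, ← insertBefore, ih, List.count_cons]
    by_cases h : a = y <;> simp [h, add_comm]

theorem isChain_filter_insertBefore (y : V) (w : List V) :
    (some y :: ((insertBefore y w).filter (fun z => decide (z = none ∨ z = some y)) ++
      [none])).IsChain (· ≠ ·) := by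
  induction w with
  | nil => simp [insertBefore]
  | cons a w ih =>
    rw [insertBefore, List.flatMap_cons, ← insertBefore]
    by_cases h : a = y <;> simpa [h] using ih

/-- The word obtained from `y p y q` by inserting `none` so that it alternates with `y` and so
that all letters other than `y` lie between its first and its last occurrence. -/
def pendantWord (y : V) (p q : List V) : List (Option V) :=
  some y :: none :: (p.map some ++ some y :: insertBefore y q) ++ [none]

theorem reduceOption_pendantWord (y : V) (p q : List V) :
    (pendantWord y p q).reduceOption = y :: p ++ y :: q := by
  have : (p.map some).reduceOption = p := by
    induction p with
    | nil => rfl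
    | cons a p ih => simpa using ih
  simp [pendantWord, List.reduceOption_append, reduceOption_insertBefore, this]

theorem kUniform_pendantWord {k : ℕ} {y : V} {p q : List V} (hp : y ∉ p)
    (h : KUniform k (y :: p ++ y :: q)) : KUniform k (pendantWord y p q) := by
  rw [kUniform_iff]
  intro v
  cases v with
  | some v => rw [← count_reduceOption, reduceOption_pendantWord, h v]
  | none =>
    have hk := h y
    have hp' : p.count y = 0 := List.count_eq_zero.2 hp
    have hn : (p.map some).count none = 0 := List.count_eq_zero.2 (by simp)
    simp only [List.cons_append, List.count_cons_self, List.count_append, hp'] at hk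
    simp [pendantWord, List.count_append, count_none_insertBefore, hn]
    lia

theorem alternate_pendantWord {y : V} {p q : List V} (hp : y ∉ p) :
    Alternate (pendantWord y p q) none (some y) := by
  have hn : (p.map some).filter (fun z => decide (z = none ∨ z = some y)) = [] := by
    rw [List.filter_eq_nil_iff]
    simpa using fun a ha (h : a = y) => hp (h ▸ ha)
  rw [alternate_iff, pendantWord]
  simp only [List.filter_append, List.filter_cons, List.cons_append, hn]
  simpa using isChain_filter_insertBefore y q

theorem not_alternate_pendantWord {k : ℕ} {y z : V} {p q : List V} (hz : z ≠ y)
    (h : KUniform k (pendantWord y p q)) : ¬ Alternate (pendantWord y p q) none (some z) := by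
  intro hA
  rw [kUniform_iff] at h
  have hc := (h none).trans (h (some z)).symm
  rw [← count_filter_pair_left _ none (some z), ← count_filter_pair_right _ none (some z)] at hc
  have hm := forall_mem_filter_pair (pendantWord y p q) none (some z)
  rw [alternate_iff] at hA
  have hf : ∃ l, (pendantWord y p q).filter (fun c => decide (c = none ∨ c = some z)) =
      none :: (l ++ [none]) := by
    refine ⟨(p.map some ++ some y :: insertBefore y q).filter
      (fun c => decide (c = none ∨ c = some z)), ?_⟩
    simp [pendantWord, List.filter_append, hz.symm]
  obtain ⟨l, hl⟩ := hf
  rw [hl] at hA hc hm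
  have hm' : ∀ c ∈ l ++ [none], c = none ∨ c = some z := fun c hc => hm c (by simp [hc])
  have hlt : (l ++ [none]).count none < (l ++ [none]).count (some z) := by
    rw [List.count_cons_self, List.count_cons_of_ne (by simp)] at hc
    lia
  have := List.isChain_ne_concat_of_count_lt (by simp) hm' hA.tail hlt
  simp [List.isChain_append] at this

variable {G : SimpleGraph V} {y : V} {G' : SimpleGraph (Option V)}

theorem KRepresentable.add_pendant {k : ℕ} (h : KRepresentable G k) (hk : 2 ≤ k)
    (hadj : ∀ a b : V, G'.Adj (some a) (some b) ↔ G.Adj a b)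
    (hleaf : ∀ a : V, G'.Adj none (some a) ↔ a = y) : KRepresentable G' k := by
  obtain ⟨w, hu, hw⟩ := h
  obtain ⟨s, t, rfl, -⟩ := List.eq_append_cons_of_mem (hw.1 y)
  have hw' := hw.append_comm hu
  have hu' := hu.perm List.perm_append_comm
  rw [List.cons_append] at hw' hu'
  have hy : y ∈ t ++ s := by
    have := hu' y
    rw [List.count_cons_self] at this
    exact List.count_pos_iff.1 (by lia)
  obtain ⟨p, q, hpq, hp⟩ := List.eq_append_cons_of_mem hy
  rw [hpq, ← List.cons_append] at hw' hu'
  have hU := kUniform_pendantWord hp hu'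
  have hnone : ∀ a, Alternate (pendantWord y p q) none (some a) ↔ G'.Adj none (some a) := by
    intro a
    rw [hleaf]
    refine ⟨fun hA => by_contra fun ha => not_alternate_pendantWord ha hU hA, ?_⟩
    rintro rfl
    exact alternate_pendantWord hp
  refine ⟨pendantWord y p q, hU, fun v => List.count_pos_iff.1 ?_, fun a b hab => ?_⟩
  · rw [kUniform_iff.1 hU v]
    lia
  · cases a with
    | none =>
      cases b with
      | none => exact absurd rfl hab
      | some b => exact hnone b
    | some a =>
      cases b with
      | none => rw [alternate_comm, G'.adj_comm, hnone]
      | some b =>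
        rw [← alternate_reduceOption, reduceOption_pendantWord, hadj]
        exact hw'.2 a b (by simpa using hab)

theorem KRepresentable.of_add_pendant {k : ℕ} (h : KRepresentable G' k)
    (hadj : ∀ a b : V, G'.Adj (some a) (some b) ↔ G.Adj a b) : KRepresentable G k := by
  obtain ⟨w, hu, hw⟩ := h
  refine ⟨w.reduceOption, fun v => ?_, fun v => List.reduceOption_mem_iff.2 (hw.1 _),
    fun a b hab => ?_⟩
  · rw [count_reduceOption, kUniform_iff.1 hu]
  · rw [alternate_reduceOption, hw.2 _ _ (by simpa using hab), hadj]

/-- Only complete graphs are represented by a word in which every letter occurs at most once. -/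
theorem KRepresentable.two_le {k : ℕ} (h : KRepresentable G k) {a b : V} (hab : a ≠ b)
    (hG : ¬ G.Adj a b) : 2 ≤ k := by
  obtain ⟨w, hu, hw⟩ := h
  by_contra hk
  have hnd : w.Nodup := List.nodup_iff_count_le_one.2 fun v => by
    rw [hu v]
    lia
  exact hG ((hw.2 a b hab).1 (List.Pairwise.isChain (hnd.filter _)))

end Pendant

/-- Let `G` be a word-representable graph with at least two vertices and representation
number `k`, and let `G'` (on vertex set `Option V`, the new vertex `x` being `none`)
be obtained from `G` by adding the new vertex together with the single edge `(x, y)`.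
Then `G'` is word-representable with representation number `max k 2`. -/
theorem reprNum_add_pendant {V : Type*} [DecidableEq V] [Fintype V]
    (G : SimpleGraph V) (hcard : 2 ≤ Fintype.card V) (k : ℕ)
    (hG : WordRepresentable G) (hR : reprNum G = k) (y : V)
    (G' : SimpleGraph (Option V))
    (hadj : ∀ a b : V, G'.Adj (some a) (some b) ↔ G.Adj a b)
    (hleaf : ∀ a : V, G'.Adj none (some a) ↔ a = y) :
    WordRepresentable G' ∧ reprNum G' = max k 2 := by
  have hk : KRepresentable G k := hR ▸ hG.kRepresentable_reprNum
  have hK' : KRepresentable G' (max k 2) :=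
    (hk.mono (le_max_left k 2)).add_pendant (le_max_right k 2) hadj hleaf
  have hG' : WordRepresentable G' := by
    obtain ⟨w, -, hw⟩ := hK'
    exact ⟨w, hw⟩
  refine ⟨hG', le_antisymm hK'.reprNum_le ?_⟩
  have hmin := hG'.kRepresentable_reprNum
  obtain ⟨z, hz⟩ := Fintype.exists_ne_of_one_lt_card hcard y
  exact max_le (hR ▸ (hmin.of_add_pendant hadj).reprNum_le)
    (hmin.two_le (a := none) (b := some z) (by simp) (by rwa [hleaf]))
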